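/- Suppose in addition that σ is convex and σ(0) = 0. Fix γ > 0, D > 0, δ ∈ (0,1), and a sample S = (x_i, y_i)_{i=1}^n. Then with probability at least 1 − δ over the draw of Θ^{(0)} (each θ_r^{(0)} distributed according to μ₀), the empirical Rademacher complexity of the ramp-loss class F over the ball Ω = {Θ ∈ (ℝ^d)^m : ‖Θ − Θ^{(0)}‖₂ ≤ D} satisfies Re(F|_S) ≤ (8 K₁ m^{1/2−β}/(γ√n))·( D + √(log(Am/δ)/b) ). -/

import Mathlib

open MeasureTheory Real Finset
open scoped RealInnerProductSpace BigOperators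

noncomputable section

/-- Two-layer network `f_Θ(x) = m^{-β} ∑_r a_r σ(θ_rᵀ x)`. -/
def fnet (d m : ℕ) (β : ℝ) (σ : ℝ → ℝ) (a : Fin m → ℝ)
    (Θ : Fin m → EuclideanSpace ℝ (Fin d)) (x : EuclideanSpace ℝ (Fin d)) : ℝ :=
  (m : ℝ) ^ (-β) * ∑ r, a r * σ ⟪Θ r, x⟫

/-- Functional-gradient value `g_Θ(x_i) = -y_i/(1+exp(y_i f_Θ(x_i)))`. -/
def gval (d m n : ℕ) (β : ℝ) (σ : ℝ → ℝ) (a : Fin m → ℝ)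
    (x : Fin n → EuclideanSpace ℝ (Fin d)) (y : Fin n → ℝ)
    (Θ : Fin m → EuclideanSpace ℝ (Fin d)) (i : Fin n) : ℝ :=
  - y i / (1 + Real.exp (y i * fnet d m β σ a Θ (x i)))

/-- Empirical logistic loss `L(Θ)`. -/
def eloss (d m n : ℕ) (β : ℝ) (σ : ℝ → ℝ) (a : Fin m → ℝ)
    (x : Fin n → EuclideanSpace ℝ (Fin d)) (y : Fin n → ℝ)
    (Θ : Fin m → EuclideanSpace ℝ (Fin d)) : ℝ :=
  (1 / n : ℝ) * ∑ i, Real.log (1 + Real.exp (- y i * fnet d m β σ a Θ (x i)))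

/-- `L¹(ν_n)`-norm of the functional gradient. -/
def L1norm (d m n : ℕ) (β : ℝ) (σ : ℝ → ℝ) (a : Fin m → ℝ)
    (x : Fin n → EuclideanSpace ℝ (Fin d)) (y : Fin n → ℝ)
    (Θ : Fin m → EuclideanSpace ℝ (Fin d)) : ℝ :=
  (1 / n : ℝ) * ∑ i, |gval d m n β σ a x y Θ i|

/-- Parameter gradient `∇_Θ L(Θ)`. -/
def gradL (d m n : ℕ) (β : ℝ) (σ : ℝ → ℝ) (a : Fin m → ℝ)
    (x : Fin n → EuclideanSpace ℝ (Fin d)) (y : Fin n → ℝ)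
    (Θ : Fin m → EuclideanSpace ℝ (Fin d)) : Fin m → EuclideanSpace ℝ (Fin d) :=
  fun r => (1 / n : ℝ) • ∑ i,
    (gval d m n β σ a x y Θ i * (a r * (m : ℝ) ^ (-β) * deriv σ ⟪Θ r, x i⟫)) • x i

/-- Squared Euclidean norm of a parameter block `‖Θ‖₂²`. -/
def nsq (d m : ℕ) (Θ : Fin m → EuclideanSpace ℝ (Fin d)) : ℝ := ∑ r, ‖Θ r‖ ^ 2

/-- Euclidean norm of a parameter block `‖Θ‖₂`. -/
def en2 (d m : ℕ) (Θ : Fin m → EuclideanSpace ℝ (Fin d)) : ℝ := Real.sqrt (nsq d m Θ)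

/-- The `(2,1)`-norm `‖Θ‖_{2,1} = ∑_r ‖θ_r‖₂`. -/
def n21 (d m : ℕ) (Θ : Fin m → EuclideanSpace ℝ (Fin d)) : ℝ := ∑ r, ‖Θ r‖

/-- Gradient-descent iterates `Θ^{(t+1)} = Θ^{(t)} - η ∇_Θ L(Θ^{(t)})`. -/
def gdSeq (d m n : ℕ) (β : ℝ) (σ : ℝ → ℝ) (a : Fin m → ℝ)
    (x : Fin n → EuclideanSpace ℝ (Fin d)) (y : Fin n → ℝ) (η : ℝ)
    (Θ0 : Fin m → EuclideanSpace ℝ (Fin d)) : ℕ → Fin m → EuclideanSpace ℝ (Fin d)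
  | 0 => Θ0
  | t + 1 => fun r => gdSeq d m n β σ a x y η Θ0 t r
      - η • gradL d m n β σ a x y (gdSeq d m n β σ a x y η Θ0 t) r

/-- Kernel-smoothing quantity `Q(Θ) = ‖(1/n) ∑_i g_Θ(x_i) ∇_Θ f_Θ(x_i)‖₂²`. -/
def Qker (d m n : ℕ) (β : ℝ) (σ : ℝ → ℝ) (a : Fin m → ℝ)
    (x : Fin n → EuclideanSpace ℝ (Fin d)) (y : Fin n → ℝ)
    (Θ : Fin m → EuclideanSpace ℝ (Fin d)) : ℝ :=
  nsq d m (fun r => (1 / n : ℝ) • ∑ i,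
    (gval d m n β σ a x y Θ i * (a r * (m : ℝ) ^ (-β) * deriv σ ⟪Θ r, x i⟫)) • x i)

/-- Symmetric signs: `a_r = 1` for `r < k`, `a_r = -1` for `r ≥ k` (with `m = 2k`). -/
def symSigns (k : ℕ) : Fin (2 * k) → ℝ := fun r => if (r : ℕ) < k then 1 else -1

/-- Symmetric initialization: `θ^{(0)}_{r+k} = θ^{(0)}_r` (with `m = 2k`). -/
def symInit (d k : ℕ) (ω : Fin k → EuclideanSpace ℝ (Fin d)) :
    Fin (2 * k) → EuclideanSpace ℝ (Fin d) :=
  fun r => if h : (r : ℕ) < k then ω ⟨r, h⟩ else ω ⟨(r : ℕ) - k, by have := r.isLt; omega⟩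

/-- Ramp loss with margin `γ`. -/
def ramp (γ v : ℝ) : ℝ := if v < 0 then 1 else if v ≤ γ then 1 - v / γ else 0

/-- Empirical Rademacher complexity of the ramp-loss class over the ball of radius `D`
around `Θ0`. -/
def rade (d m n : ℕ) (β γ D : ℝ) (σ : ℝ → ℝ) (a : Fin m → ℝ)
    (x : Fin n → EuclideanSpace ℝ (Fin d)) (y : Fin n → ℝ)
    (Θ0 : Fin m → EuclideanSpace ℝ (Fin d)) : ℝ :=
  (1 / n : ℝ) * (1 / 2 ^ n : ℝ) * ∑ ε : Fin n → Bool,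
    sSup {z : ℝ | ∃ Θ : Fin m → EuclideanSpace ℝ (Fin d),
      en2 d m (fun r => Θ r - Θ0 r) ≤ D ∧
      z = ∑ i, (if ε i then (1 : ℝ) else -1) * ramp γ (y i * fnet d m β σ a Θ (x i))}

/-- Neural tangent kernel. -/
def kNTK (d : ℕ) (σ : ℝ → ℝ) (μ₀ : Measure (EuclideanSpace ℝ (Fin d)))
    (x x' : EuclideanSpace ℝ (Fin d)) : ℝ :=
  ∫ θ, deriv σ ⟪θ, x⟫ * deriv σ ⟪θ, x'⟫ * ⟪x, x'⟫ ∂μ₀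

/-- The sign encoded by a Boolean. -/
def boolSign (b : Bool) : ℝ := if b then 1 else -1

lemma boolSign_not (b : Bool) : boolSign (!b) = -boolSign b := by
  cases b <;> simp [boolSign]

lemma boolSign_sq (b : Bool) : boolSign b ^ 2 = 1 := by
  cases b <;> simp [boolSign]

lemma abs_boolSign (b : Bool) : |boolSign b| = 1 := by
  cases b <;> simp [boolSign]

/-- Flip one coordinate of a sign vector. -/
def flipAt {ι : Type*} [DecidableEq ι] (k : ι) (ε : ι → Bool) : ι → Bool :=
  Function.update ε k (!ε k)

section Signs

variable {ι : Type*} [DecidableEq ι]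

lemma flipAt_self (k : ι) (ε : ι → Bool) : flipAt k ε k = !ε k := by
  simp [flipAt]

lemma flipAt_of_ne {k i : ι} (h : i ≠ k) (ε : ι → Bool) : flipAt k ε i = ε i := by
  simp [flipAt, h]

lemma flipAt_involutive (k : ι) : Function.Involutive (flipAt k) := by
  intro ε
  ext i
  by_cases h : i = k
  · subst h; simp [flipAt_self]
  · simp [flipAt_of_ne h]

variable [Fintype ι]

lemma sum_flipAt (k : ι) (F : (ι → Bool) → ℝ) : ∑ ε, F (flipAt k ε) = ∑ ε, F ε :=
  Equiv.sum_comp (flipAt_involutive k).toPerm F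

lemma sum_le_sum_of_flipAt (k : ι) {F G : (ι → Bool) → ℝ}
    (h : ∀ ε, F ε + F (flipAt k ε) ≤ G ε + G (flipAt k ε)) : ∑ ε, F ε ≤ ∑ ε, G ε := by
  have h' := Finset.sum_le_sum fun ε (_ : ε ∈ univ) => h ε
  rw [Finset.sum_add_distrib, Finset.sum_add_distrib, sum_flipAt, sum_flipAt] at h'
  linarith

lemma sum_boolSign_mul_eq_zero (k : ι) (Y : (ι → Bool) → ℝ)
    (hY : ∀ ε, Y (flipAt k ε) = Y ε) : ∑ ε, boolSign (ε k) * Y ε = 0 := by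
  have h := sum_flipAt k fun ε => boolSign (ε k) * Y ε
  simp only [flipAt_self, boolSign_not, hY, neg_mul, Finset.sum_neg_distrib] at h
  linarith

lemma sum_le_of_sum_sq_le (M : (ι → Bool) → ℝ) (C : ℝ) (hC : 0 ≤ C)
    (h : ∑ ε, M ε ^ 2 ≤ 2 ^ Fintype.card ι * C ^ 2) :
    ∑ ε, M ε ≤ 2 ^ Fintype.card ι * C := by
  have h1 := sq_sum_le_card_mul_sum_sq (s := (univ : Finset (ι → Bool))) (f := M)
  have h2 : ((univ : Finset (ι → Bool)).card : ℝ) = 2 ^ Fintype.card ι := by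
    simp
  rw [h2] at h1
  refine (le_abs_self _).trans (abs_le_of_sq_le_sq ?_ (by positivity))
  calc (∑ ε, M ε) ^ 2 ≤ 2 ^ Fintype.card ι * ∑ ε, M ε ^ 2 := h1
    _ ≤ 2 ^ Fintype.card ι * (2 ^ Fintype.card ι * C ^ 2) := by gcongr
    _ = _ := by ring

/-- Replacing one coordinate function by a function dominating its increments does not decrease
the expected supremum of a Rademacher process. The supremum is expressed through selections. -/
lemma exists_selection_update {T : Type*} (f : ι → T → ℝ) (k : ι) (G : T → ℝ)
    (hG : ∀ s t, |f k s - f k t| ≤ |G s - G t|) (τ : (ι → Bool) → T) :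
    ∃ τ' : (ι → Bool) → T, ∑ ε, ∑ i, boolSign (ε i) * f i (τ ε) ≤
      ∑ ε, ∑ i, boolSign (ε i) * Function.update f k G i (τ' ε) := by
  classical
  let R : (ι → Bool) → T → ℝ := fun ε t => ∑ i ∈ univ.erase k, boolSign (ε i) * f i t
  have hR : ∀ ε, R (flipAt k ε) = R ε := by
    intro ε
    funext t
    refine Finset.sum_congr rfl fun i hi => ?_
    rw [flipAt_of_ne (Finset.ne_of_mem_erase hi)]
  have e1 : ∀ ε t, ∑ i, boolSign (ε i) * f i t = boolSign (ε k) * f k t + R ε t :=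
    fun ε t => (Finset.add_sum_erase _ _ (mem_univ k)).symm
  have e2 : ∀ ε t, ∑ i, boolSign (ε i) * Function.update f k G i t
      = boolSign (ε k) * G t + R ε t := by
    intro ε t
    rw [← Finset.add_sum_erase _ _ (mem_univ k), Function.update_self]
    congr 1
    refine Finset.sum_congr rfl fun i hi => ?_
    rw [Function.update_of_ne (Finset.ne_of_mem_erase hi)]
  let τ' : (ι → Bool) → T := fun ε =>
    if boolSign (ε k) * G (τ (flipAt k ε)) ≤ boolSign (ε k) * G (τ ε) then τ ε
    else τ (flipAt k ε)
  refine ⟨τ', ?_⟩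
  simp only [e1, e2]
  refine sum_le_sum_of_flipAt k fun ε => ?_
  have hl := hG (τ ε) (τ (flipAt k ε))
  have hl1 := (le_abs_self _).trans hl
  have hl2 := (neg_le_abs _).trans hl
  simp only [τ', flipAt_self, boolSign_not, hR, (flipAt_involutive k) ε]
  rcases Bool.eq_false_or_eq_true (ε k) with hk | hk <;> simp only [hk, boolSign] <;>
    rcases le_total (G (τ ε)) (G (τ (flipAt k ε))) with hle | hle <;>
    rcases eq_or_ne (G (τ ε)) (G (τ (flipAt k ε))) with heq | hne <;>
    (first
      | rw [abs_of_nonneg (sub_nonneg.2 hle)] at hl1 hl2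
      | rw [abs_of_nonpos (sub_nonpos.2 hle)] at hl1 hl2) <;>
    split_ifs <;> simp_all <;> linarith

/-- Contraction principle for Rademacher processes, in terms of selections. -/
lemma exists_selection_contraction {T : Type*} (f g : ι → T → ℝ)
    (hfg : ∀ i s t, |f i s - f i t| ≤ |g i s - g i t|) (τ : (ι → Bool) → T) :
    ∃ τ' : (ι → Bool) → T, ∑ ε, ∑ i, boolSign (ε i) * f i (τ ε) ≤
      ∑ ε, ∑ i, boolSign (ε i) * g i (τ' ε) := by
  classical
  have key : ∀ S : Finset ι, ∃ τ' : (ι → Bool) → T, ∑ ε, ∑ i, boolSign (ε i) * f i (τ ε) ≤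
      ∑ ε, ∑ i, boolSign (ε i) * S.piecewise g f i (τ' ε) := by
    intro S
    induction S using Finset.induction_on with
    | empty => exact ⟨τ, by simp⟩
    | insert k S hk ih =>
      obtain ⟨τ₁, h₁⟩ := ih
      obtain ⟨τ₂, h₂⟩ := exists_selection_update (S.piecewise g f) k (g k)
        (by simpa [Finset.piecewise_eq_of_notMem _ _ _ hk] using hfg k) τ₁
      refine ⟨τ₂, h₁.trans (h₂.trans_eq ?_)⟩
      rw [Finset.piecewise_insert]
  obtain ⟨τ', h⟩ := key univ
  exact ⟨τ', by simpa using h⟩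

lemma sum_norm_sq_rademacher_sum {E : Type*} [NormedAddCommGroup E] [InnerProductSpace ℝ E]
    (x : ι → E) (S : Finset ι) :
    ∑ ε : ι → Bool, ‖∑ i ∈ S, boolSign (ε i) • x i‖ ^ 2
      = 2 ^ Fintype.card ι * ∑ i ∈ S, ‖x i‖ ^ 2 := by
  induction S using Finset.induction_on with
  | empty => simp
  | insert k S hk ih =>
    have hz := sum_boolSign_mul_eq_zero k
      (fun ε => 2 * ⟪x k, ∑ i ∈ S, boolSign (ε i) • x i⟫) (by
        intro ε
        congr 2
        refine Finset.sum_congr rfl fun i hi => ?_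
        rw [flipAt_of_ne (ne_of_mem_of_not_mem hi hk)])
    have he : ∀ ε : ι → Bool, ‖∑ i ∈ insert k S, boolSign (ε i) • x i‖ ^ 2 =
        ‖x k‖ ^ 2 + boolSign (ε k) * (2 * ⟪x k, ∑ i ∈ S, boolSign (ε i) • x i⟫)
          + ‖∑ i ∈ S, boolSign (ε i) • x i‖ ^ 2 := by
      intro ε
      rw [Finset.sum_insert hk, norm_add_sq_real, norm_smul, mul_pow, Real.norm_eq_abs, sq_abs,
        boolSign_sq, real_inner_smul_left]
      ring
    rw [Finset.sum_congr rfl fun ε _ => he ε, Finset.sum_add_distrib, Finset.sum_add_distrib, hz,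
      ih, Finset.sum_insert hk]
    simp
    ring

lemma sum_norm_rademacher_sum_le {E : Type*} [NormedAddCommGroup E] [InnerProductSpace ℝ E]
    (x : ι → E) (hx : ∀ i, ‖x i‖ ≤ 1) :
    ∑ ε : ι → Bool, ‖∑ i, boolSign (ε i) • x i‖
      ≤ 2 ^ Fintype.card ι * √(Fintype.card ι) := by
  refine sum_le_of_sum_sq_le _ _ (by positivity) ?_
  rw [sum_norm_sq_rademacher_sum, Real.sq_sqrt (by positivity)]
  gcongr
  calc ∑ i, ‖x i‖ ^ 2 ≤ ∑ _i : ι, (1 : ℝ) :=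
        Finset.sum_le_sum fun i _ => pow_le_one₀ (norm_nonneg _) (hx i)
    _ = _ := by simp

/-- A maximal function for signed sums along the one-parameter family `i ↦ min (w * c i) 1`. -/
lemma exists_maximal_function (c : ι → ℝ) (hc : ∀ i, 0 ≤ c i) (s : ι → ℝ)
    (hs : ∀ i, |s i| ≤ 1) (S : Finset ι) :
    ∃ M : (ι → Bool) → ℝ, (∀ k ∉ S, ∀ ε, M (flipAt k ε) = M ε) ∧ (∀ ε, 0 ≤ M ε) ∧
      ∑ ε, M ε ^ 2 ≤ 2 ^ Fintype.card ι * S.card ∧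
      ∀ ε (w B : ℝ), 0 ≤ w → 0 ≤ B → (∀ i ∈ S, min (w * c i) 1 ≤ B) →
        ∑ i ∈ S, boolSign (ε i) * (s i * min (w * c i) 1) ≤ B * M ε := by
  induction S using Finset.induction_on_max_value c with
  | empty => exact ⟨0, by simp⟩
  | insert k S hk hmax ih =>
    obtain ⟨M, hinv, hpos, hsq, hle⟩ := ih
    refine ⟨fun ε => max 0 (boolSign (ε k) * s k + M ε), ?_, fun ε => le_max_left _ _, ?_, ?_⟩
    · intro j hj ε
      rw [Finset.mem_insert, not_or] at hj
      simp only
      rw [hinv j hj.2, flipAt_of_ne (Ne.symm hj.1)]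
    · have hz := sum_boolSign_mul_eq_zero k (fun ε => 2 * s k * M ε)
        (fun ε => by simp only [hinv k hk])
      have hp : ∀ ε : ι → Bool, max 0 (boolSign (ε k) * s k + M ε) ^ 2 ≤
          1 + boolSign (ε k) * (2 * s k * M ε) + M ε ^ 2 := by
        intro ε
        have h1 : max 0 (boolSign (ε k) * s k + M ε) ^ 2 ≤ (boolSign (ε k) * s k + M ε) ^ 2 := by
          rcases max_cases 0 (boolSign (ε k) * s k + M ε) with h | h <;> rw [h.1]
          simpa using sq_nonneg (boolSign (ε k) * s k + M ε)
        have h2 : s k ^ 2 ≤ 1 := (sq_le_one_iff_abs_le_one _).2 (hs k)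
        have h3 : (boolSign (ε k) * s k) ^ 2 ≤ 1 := by rwa [mul_pow, boolSign_sq, one_mul]
        nlinarith
      refine (Finset.sum_le_sum fun ε _ => hp ε).trans ?_
      rw [Finset.sum_add_distrib, Finset.sum_add_distrib, hz, Finset.card_insert_of_notMem hk]
      push_cast
      simp only [Finset.sum_const, Finset.card_univ, Fintype.card_fun, Fintype.card_bool,
        nsmul_eq_mul, Nat.cast_pow, Nat.cast_ofNat]
      linarith
    · intro ε w B hw hB hb
      rw [Finset.sum_insert hk]
      have h0 : 0 ≤ min (w * c k) 1 := le_min (mul_nonneg hw (hc k)) zero_le_one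
      have h1 := hle ε w (min (w * c k) 1) hw h0 (fun i hi =>
        min_le_min_right _ (mul_le_mul_of_nonneg_left (hmax i hi) hw))
      have h2 := hb k (Finset.mem_insert_self _ _)
      calc boolSign (ε k) * (s k * min (w * c k) 1)
            + ∑ i ∈ S, boolSign (ε i) * (s i * min (w * c i) 1)
          ≤ min (w * c k) 1 * (boolSign (ε k) * s k + M ε) := by linarith
        _ ≤ min (w * c k) 1 * max 0 (boolSign (ε k) * s k + M ε) := by
            gcongr; exact le_max_right _ _
        _ ≤ B * max 0 (boolSign (ε k) * s k + M ε) := by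
            gcongr

lemma sum_signed_truncation_le (c : ι → ℝ) (hc : ∀ i, 0 ≤ c i) (s : ι → ℝ)
    (hs : ∀ i, |s i| ≤ 1) (w : (ι → Bool) → ℝ) (hw : ∀ ε, 0 ≤ w ε) :
    ∑ ε, ∑ i, boolSign (ε i) * (s i * min (w ε * c i) 1)
      ≤ 2 ^ Fintype.card ι * √(Fintype.card ι) := by
  obtain ⟨M, -, -, hsq, hle⟩ := exists_maximal_function c hc s hs univ
  calc _ ≤ ∑ ε, M ε := Finset.sum_le_sum fun ε _ => by
        simpa using hle ε (w ε) 1 (hw ε) zero_le_one fun i _ => min_le_right _ _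
    _ ≤ _ := by
        refine sum_le_of_sum_sq_le _ _ (by positivity) ?_
        rwa [Real.sq_sqrt (by positivity)]

end Signs

/-- Efron–Stein inequality on the hypercube, for functions with increments at most `2`. -/
lemma sum_sq_le_of_bounded_differences (n : ℕ) (Z : (Fin n → Bool) → ℝ)
    (hZ : ∀ ε i b, |Z ε - Z (Function.update ε i b)| ≤ 2) :
    2 ^ n * ∑ ε, Z ε ^ 2 ≤ (∑ ε, Z ε) ^ 2 + n * (2 ^ n) ^ 2 := by
  induction n with
  | zero => simp
  | succ n ih =>
    have hsum : ∀ F : (Fin (n + 1) → Bool) → ℝ, ∑ ε, F ε =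
        ∑ ε : Fin n → Bool, (F (Fin.cons true ε) + F (Fin.cons false ε)) := by
      intro F
      rw [← (Fin.consEquiv fun _ => Bool).sum_comp, Fintype.sum_prod_type]
      simp [Fin.consEquiv, Finset.sum_add_distrib]
    let f : (Fin n → Bool) → ℝ := fun ε => (Z (Fin.cons true ε) + Z (Fin.cons false ε)) / 2
    have hf : ∀ ε i b, |f ε - f (Function.update ε i b)| ≤ 2 := by
      intro ε i b
      have h1 := hZ (Fin.cons true ε) i.succ b
      have h2 := hZ (Fin.cons false ε) i.succ b
      rw [← Fin.cons_update, abs_le] at h1 h2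
      simp only [f]
      rw [abs_le]
      constructor <;> linarith [h1.1, h1.2, h2.1, h2.2]
    have h := ih f hf
    have e1 : ∑ ε, Z ε = 2 * ∑ ε, f ε := by
      rw [hsum, Finset.mul_sum]
      exact Finset.sum_congr rfl fun ε _ => by simp only [f]; ring
    have e2 : ∑ ε, Z ε ^ 2 ≤ 2 * ∑ ε, f ε ^ 2 + 2 * 2 ^ n := by
      rw [hsum]
      have : ∑ ε : Fin n → Bool, (2 * f ε ^ 2 + 2) = 2 * ∑ ε, f ε ^ 2 + 2 * 2 ^ n := by
        rw [Finset.sum_add_distrib, Finset.mul_sum]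
        simp
        ring
      rw [← this]
      refine Finset.sum_le_sum fun ε _ => ?_
      have h1 := hZ (Fin.cons true ε) 0 false
      rw [Fin.update_cons_zero] at h1
      have h2 := sq_le_sq' (abs_le.1 h1).1 (abs_le.1 h1).2
      simp only [f]
      nlinarith
    rw [e1]
    push_cast
    have : (0 : ℝ) < 2 ^ n := by positivity
    rw [pow_succ]
    nlinarith

section Neuron

variable {E : Type*} [NormedAddCommGroup E] [InnerProductSpace ℝ E] {n : ℕ}

/-- Truncating the offset at the size of the increment does not change `|c + p| - |c|`. -/
lemma abs_add_sub_abs_eq_truncation (c p : ℝ) (hp : |p| ≤ 1) :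
    |c + p| - |c| = |SignType.sign c * min |c| 1 + p| - min |c| 1 := by
  obtain ⟨h1, h2⟩ := abs_le.1 hp
  rcases lt_trichotomy c 0 with hc | hc | hc
  · simp only [sign_neg hc, abs_of_neg hc, SignType.coe_neg_one]
    rcases le_total (-c) 1 with h | h
    · rw [min_eq_left h]; simp
    · rw [min_eq_right h, abs_of_nonpos (by linarith), abs_of_nonpos (by linarith)]; ring
  · subst hc; simp
  · simp only [sign_pos hc, abs_of_pos hc, SignType.coe_one]
    rcases le_total c 1 with h | h
    · rw [min_eq_left h]; simp
    · rw [min_eq_right h, abs_of_nonneg (by linarith), abs_of_nonneg (by linarith)]; ring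

lemma abs_sign_cast_le_one (c : ℝ) : |((SignType.sign c : SignType) : ℝ)| ≤ 1 := by
  rcases lt_trichotomy c 0 with hc | hc | hc
  · simp [sign_neg hc]
  · simp [hc]
  · simp [sign_pos hc]

lemma sum_neuron_increment_le (x : Fin n → E) (hx : ∀ i, ‖x i‖ ≤ 1) (c : Fin n → ℝ) (a : ℝ)
    (ha : |a| = 1) (q : (Fin n → Bool) → {q : E × ℝ // ‖q.1‖ ≤ 1 ∧ 0 ≤ q.2}) :
    ∑ ε, ∑ i, boolSign (ε i) *
      (a * (|(q ε).1.2 * c i + ⟪(q ε).1.1, x i⟫| - |(q ε).1.2 * c i|)) ≤ 2 ^ n * (3 * √n) := by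
  have hin : ∀ (u : E) (i : Fin n), ‖u‖ ≤ 1 → |⟪u, x i⟫| ≤ 1 := fun u i hu =>
    (abs_real_inner_le_norm _ _).trans (mul_le_one₀ hu (norm_nonneg _) (hx i))
  let g : Fin n → {q : E × ℝ // ‖q.1‖ ≤ 1 ∧ 0 ≤ q.2} → ℝ := fun i q =>
    SignType.sign (c i) * min (q.1.2 * |c i|) 1 + ⟪q.1.1, x i⟫
  have hsgn : ∀ (w : ℝ) (i : Fin n) (p : ℝ), 0 ≤ w → |p| ≤ 1 → |w * c i + p| - |w * c i| =
      |SignType.sign (c i) * min (w * |c i|) 1 + p| - min (w * |c i|) 1 := by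
    intro w i p hw hp
    rcases hw.eq_or_lt with rfl | hw
    · simp
    · rw [abs_add_sub_abs_eq_truncation _ _ hp, sign_mul, sign_pos hw, one_mul, abs_mul,
        abs_of_pos hw]
  obtain ⟨q', hq'⟩ := exists_selection_contraction (fun i t => a * |g i t|) g (by
    intro i s t
    rw [← mul_sub, abs_mul, ha, one_mul]
    exact abs_abs_sub_abs_le_abs_sub _ _) q
  have b1 := sum_signed_truncation_le (fun i => |c i|) (fun i => abs_nonneg _)
    (fun _ => -a) (fun i => by rw [abs_neg, ha]) (fun ε => (q ε).1.2) (fun ε => (q ε).2.2)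
  have b2 := sum_signed_truncation_le (fun i => |c i|) (fun i => abs_nonneg _)
    (fun i => SignType.sign (c i)) (fun i => abs_sign_cast_le_one _)
    (fun ε => (q' ε).1.2) (fun ε => (q' ε).2.2)
  have b3 : ∑ ε, ∑ i, boolSign (ε i) * ⟪(q' ε).1.1, x i⟫ ≤ 2 ^ n * √n := by
    have h := sum_norm_rademacher_sum_le x hx
    rw [Fintype.card_fin] at h
    refine le_trans (Finset.sum_le_sum fun ε _ => ?_) h
    have e : ∑ i, boolSign (ε i) * ⟪(q' ε).1.1, x i⟫
        = ⟪(q' ε).1.1, ∑ i, boolSign (ε i) • x i⟫ := by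
      rw [inner_sum]; simp only [real_inner_smul_right]
    rw [e]
    exact (real_inner_le_norm _ _).trans
      (mul_le_of_le_one_left (norm_nonneg _) (q' ε).2.1)
  have e1 : ∑ ε, ∑ i, boolSign (ε i) *
      (a * (|(q ε).1.2 * c i + ⟪(q ε).1.1, x i⟫| - |(q ε).1.2 * c i|)) =
      ∑ ε, ∑ i, boolSign (ε i) * (a * |g i (q ε)|) +
      ∑ ε, ∑ i, boolSign (ε i) * (-a * min ((q ε).1.2 * |c i|) 1) := by
    simp only [← Finset.sum_add_distrib]
    refine Finset.sum_congr rfl fun ε _ => Finset.sum_congr rfl fun i _ => ?_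
    rw [hsgn _ i _ (q ε).2.2 (hin _ i (q ε).2.1)]
    ring
  have e2 : ∑ ε, ∑ i, boolSign (ε i) * g i (q' ε) =
      ∑ ε, ∑ i, boolSign (ε i) * (SignType.sign (c i) * min ((q' ε).1.2 * |c i|) 1) +
      ∑ ε, ∑ i, boolSign (ε i) * ⟪(q' ε).1.1, x i⟫ := by
    simp only [← Finset.sum_add_distrib]
    refine Finset.sum_congr rfl fun ε _ => Finset.sum_congr rfl fun i _ => ?_
    simp only [g]
    ring
  rw [Fintype.card_fin] at b1 b2
  rw [e1]
  linarith

/-- A square-integrable envelope for the increments of the neuron `z ↦ |z|` at all scales. -/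
lemma exists_neuron_envelope (x : Fin n → E) (hx : ∀ i, ‖x i‖ ≤ 1) (c : Fin n → ℝ) (a : ℝ)
    (ha : |a| = 1) :
    ∃ Z : (Fin n → Bool) → ℝ, ∑ ε, Z ε ^ 2 ≤ 2 ^ n * (10 * n) ∧
      ∀ ε (v : E), ∑ i, boolSign (ε i) * (a * (|c i + ⟪v, x i⟫| - |c i|)) ≤ ‖v‖ * Z ε := by
  let T := {q : E × ℝ // ‖q.1‖ ≤ 1 ∧ 0 ≤ q.2}
  let h : Fin n → T → ℝ := fun i q => a * (|q.1.2 * c i + ⟪q.1.1, x i⟫| - |q.1.2 * c i|)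
  let q₀ : T := ⟨(0, 0), by simp⟩
  have hh : ∀ i q, |h i q| ≤ 1 := by
    intro i q
    simp only [h]
    rw [abs_mul, ha, one_mul]
    refine (abs_abs_sub_abs_le_abs_sub _ _).trans ?_
    rw [add_sub_cancel_left]
    exact (abs_real_inner_le_norm _ _).trans (mul_le_one₀ q.2.1 (norm_nonneg _) (hx i))
  have : Nonempty T := ⟨q₀⟩
  let Z : (Fin n → Bool) → ℝ := fun ε => ⨆ q : T, ∑ i, boolSign (ε i) * h i q
  have hbdd : ∀ ε : Fin n → Bool, BddAbove (Set.range fun q : T => ∑ i, boolSign (ε i) * h i q) := by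
    intro ε
    refine ⟨∑ _i : Fin n, 1, ?_⟩
    rintro _ ⟨q, rfl⟩
    refine Finset.sum_le_sum fun i _ => (le_abs_self _).trans ?_
    rw [abs_mul, abs_boolSign, one_mul]
    exact hh i q
  have hle : ∀ ε q, ∑ i, boolSign (ε i) * h i q ≤ Z ε := fun ε q => le_ciSup (hbdd ε) q
  have hZ0 : ∀ ε, 0 ≤ Z ε := fun ε => by simpa [h, q₀] using hle ε q₀
  have hone : ∀ ε i b, Z ε ≤ Z (Function.update ε i b) + 2 := by
    intro ε k b
    refine ciSup_le fun q => ?_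
    have h1 := hle (Function.update ε k b) q
    rw [← Finset.add_sum_erase _ _ (mem_univ k)] at h1 ⊢
    have h2 : ∑ i ∈ univ.erase k, boolSign (Function.update ε k b i) * h i q =
        ∑ i ∈ univ.erase k, boolSign (ε i) * h i q :=
      Finset.sum_congr rfl fun i hi => by
        rw [Function.update_of_ne (Finset.ne_of_mem_erase hi)]
    rw [h2] at h1
    have h3 : |boolSign (ε k) * h k q| ≤ 1 := by
      rw [abs_mul, abs_boolSign, one_mul]; exact hh k q
    have h4 : |boolSign (Function.update ε k b k) * h k q| ≤ 1 := by
      rw [abs_mul, abs_boolSign, one_mul]; exact hh k q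
    linarith [(abs_le.1 h3).2, (abs_le.1 h4).1]
  have hdiff : ∀ ε i b, |Z ε - Z (Function.update ε i b)| ≤ 2 := by
    intro ε i b
    have h1 := hone ε i b
    have h2 := hone (Function.update ε i b) i (ε i)
    rw [Function.update_idem, Function.update_eq_self] at h2
    rw [abs_le]
    constructor <;> linarith
  have hmean : ∑ ε, Z ε ≤ 2 ^ n * (3 * √n) := by
    refine le_of_forall_pos_le_add fun η hη => ?_
    have hex : ∀ ε, ∃ q : T, Z ε - η / 2 ^ n < ∑ i, boolSign (ε i) * h i q := fun ε =>
      exists_lt_of_lt_ciSup (sub_lt_self _ (by positivity))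
    choose q hq using hex
    have h1 := sum_neuron_increment_le x hx c a ha q
    have h2 := Finset.sum_le_sum fun ε (_ : ε ∈ univ) => (hq ε).le
    rw [Finset.sum_sub_distrib] at h2
    simp only [Finset.sum_const, Finset.card_univ, Fintype.card_fun, Fintype.card_bool,
      Fintype.card_fin, nsmul_eq_mul, Nat.cast_pow, Nat.cast_ofNat] at h2
    rw [mul_div_cancel₀ _ (by positivity)] at h2
    simp only [h] at h2
    linarith
  refine ⟨Z, ?_, ?_⟩
  · have h1 := sum_sq_le_of_bounded_differences n Z hdiff
    have h2 : (∑ ε, Z ε) ^ 2 ≤ (2 ^ n * (3 * √n)) ^ 2 :=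
      pow_le_pow_left₀ (Finset.sum_nonneg fun ε _ => hZ0 ε) hmean 2
    rw [mul_pow, mul_pow, Real.sq_sqrt (by positivity)] at h2
    refine le_of_mul_le_mul_left (a := (2 : ℝ) ^ n) ?_ (by positivity)
    linarith
  · intro ε v
    rcases eq_or_ne v 0 with rfl | hv
    · simp
    · have hv' : 0 < ‖v‖ := norm_pos_iff.2 hv
      have h1 := hle ε ⟨(‖v‖⁻¹ • v, ‖v‖⁻¹), by
        rw [norm_smul, norm_inv, norm_norm, inv_mul_cancel₀ hv'.ne'], by positivity⟩
      refine le_trans (le_of_eq ?_) (mul_le_mul_of_nonneg_left h1 hv'.le)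
      rw [Finset.mul_sum]
      refine Finset.sum_congr rfl fun i _ => ?_
      simp only [h]
      rw [real_inner_smul_left, ← mul_add, abs_mul, abs_mul, abs_of_pos (inv_pos.2 hv')]
      field_simp

end Neuron

section Activation

/-- A `C²` function on `[-B, B]` is an affine function plus a superposition of the functions
`z ↦ |z - s|` with weights given by its second derivative. -/
lemma integral_deriv2_mul_abs_sub {σ : ℝ → ℝ} (hσ : ContDiff ℝ 2 σ) {B z : ℝ}
    (hz : |z| ≤ B) :
    ∫ s in -B..B, deriv (deriv σ) s * |z - s| =
      2 * σ z - z * (deriv σ (-B) + deriv σ B)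
        + (B * (deriv σ B - deriv σ (-B)) - σ (-B) - σ B) := by
  obtain ⟨h1, h2⟩ := abs_le.1 hz
  have hd1 : ContDiff ℝ 1 (deriv σ) := ((contDiff_succ_iff_deriv (n := 1)).1 hσ).2.2
  have hd : ∀ s, HasDerivAt σ (deriv σ s) s := fun s =>
    ((hσ.differentiable (by norm_num)) s).hasDerivAt
  have hdd : ∀ s, HasDerivAt (deriv σ) (deriv (deriv σ) s) s := fun s =>
    ((hd1.differentiable (by norm_num)) s).hasDerivAt
  have hc : Continuous (deriv (deriv σ)) := hd1.continuous_deriv le_rfl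
  have hF : ∀ s, HasDerivAt (fun s => deriv σ s * (z - s) + σ s)
      (deriv (deriv σ) s * (z - s)) s := by
    intro s
    have h := ((hdd s).mul ((hasDerivAt_id s).const_sub z)).add (hd s)
    refine h.congr_deriv ?_
    simp only [id]
    ring
  have hint : ∀ p q : ℝ, ∫ s in p..q, deriv (deriv σ) s * (z - s) =
      (deriv σ q * (z - q) + σ q) - (deriv σ p * (z - p) + σ p) := fun p q =>
    intervalIntegral.integral_eq_sub_of_hasDerivAt (fun s _ => hF s)
      ((by fun_prop : Continuous fun s => deriv (deriv σ) s * (z - s)).intervalIntegrable _ _)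
  have hcont : Continuous fun s => deriv (deriv σ) s * |z - s| := by fun_prop
  rw [← intervalIntegral.integral_add_adjacent_intervals (hcont.intervalIntegrable (-B) z)
    (hcont.intervalIntegrable z B)]
  have e1 : ∫ s in -B..z, deriv (deriv σ) s * |z - s|
      = ∫ s in -B..z, deriv (deriv σ) s * (z - s) := by
    refine intervalIntegral.integral_congr fun s hs => ?_
    rw [Set.uIcc_of_le h1] at hs
    simp only [abs_of_nonneg (sub_nonneg.2 hs.2)]
  have e2 : ∫ s in z..B, deriv (deriv σ) s * |z - s|
      = -∫ s in z..B, deriv (deriv σ) s * (z - s) := by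
    rw [← intervalIntegral.integral_neg]
    refine intervalIntegral.integral_congr fun s hs => ?_
    rw [Set.uIcc_of_le h2] at hs
    simp only [abs_of_nonpos (sub_nonpos.2 hs.1)]
    ring
  rw [e1, e2, hint, hint]
  ring

/-- A bound on increments that is uniform over the functions `z ↦ |z - s|` transfers to
convex functions. -/
lemma sum_mul_convex_sub_le {κ : Type*} [Fintype κ] {σ : ℝ → ℝ} {K B C : ℝ}
    (hσ : ContDiff ℝ 2 σ) (hK : ∀ z, |deriv σ z| ≤ K) (hconv : ConvexOn ℝ Set.univ σ)
    (hB : 0 ≤ B) (hC : 0 ≤ C) (w z z' : κ → ℝ) (hz : ∀ k, |z k| ≤ B) (hz' : ∀ k, |z' k| ≤ B)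
    (h : ∀ s, ∑ k, w k * (|z' k - s| - |z k - s|) ≤ C) :
    ∑ k, w k * (σ (z' k) - σ (z k)) ≤
      ∑ k, w k * ((deriv σ (-B) + deriv σ B) / 2 * (z' k - z k)) + K * C := by
  have hd1 : ContDiff ℝ 1 (deriv σ) := ((contDiff_succ_iff_deriv (n := 1)).1 hσ).2.2
  have hc : Continuous (deriv (deriv σ)) := hd1.continuous_deriv le_rfl
  have hmono : Monotone (deriv σ) := by
    rw [← monotoneOn_univ]
    exact hconv.monotoneOn_deriv fun s _ => (hσ.differentiable (by norm_num)) s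
  have hmass : ∫ s in -B..B, deriv (deriv σ) s = deriv σ B - deriv σ (-B) :=
    intervalIntegral.integral_eq_sub_of_hasDerivAt
      (fun s _ => ((hd1.differentiable (by norm_num)) s).hasDerivAt) (hc.intervalIntegrable _ _)
  have hi : ∀ p : ℝ, IntervalIntegrable (fun s => deriv (deriv σ) s * |p - s|) volume (-B) B :=
    fun p => (by fun_prop : Continuous fun s => deriv (deriv σ) s * |p - s|).intervalIntegrable _ _
  have hsum : ∫ s in -B..B, deriv (deriv σ) s * ∑ k, w k * (|z' k - s| - |z k - s|) =
      ∑ k, w k * (2 * (σ (z' k) - σ (z k))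
        - (deriv σ (-B) + deriv σ B) * (z' k - z k)) := by
    have e : ∀ s, deriv (deriv σ) s * ∑ k, w k * (|z' k - s| - |z k - s|) =
        ∑ k, w k * (deriv (deriv σ) s * |z' k - s| - deriv (deriv σ) s * |z k - s|) := by
      intro s
      rw [Finset.mul_sum]
      exact Finset.sum_congr rfl fun k _ => by ring
    simp only [e]
    rw [intervalIntegral.integral_finsetSum fun k _ => ((hi _).sub (hi _)).const_mul _]
    refine Finset.sum_congr rfl fun k _ => ?_
    rw [intervalIntegral.integral_const_mul, intervalIntegral.integral_sub (hi _) (hi _),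
      integral_deriv2_mul_abs_sub hσ (hz k), integral_deriv2_mul_abs_sub hσ (hz' k)]
    ring
  have hle : ∫ s in -B..B, deriv (deriv σ) s * ∑ k, w k * (|z' k - s| - |z k - s|) ≤
      ∫ s in -B..B, deriv (deriv σ) s * C := by
    refine intervalIntegral.integral_mono_on (by linarith) ?_ ?_ fun s _ =>
      mul_le_mul_of_nonneg_left (h s) hmono.deriv_nonneg
    · exact (by fun_prop : Continuous fun s =>
        deriv (deriv σ) s * ∑ k, w k * (|z' k - s| - |z k - s|)).intervalIntegrable _ _
    · exact (by fun_prop : Continuous fun s => deriv (deriv σ) s * C).intervalIntegrable _ _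
  rw [hsum, intervalIntegral.integral_mul_const, hmass] at hle
  have h1 := (abs_le.1 (hK B)).2
  have h2 := (abs_le.1 (hK (-B))).1
  have h3 : (deriv σ B - deriv σ (-B)) * C ≤ 2 * K * C := by
    gcongr; linarith
  have h4 : ∑ k, w k * (2 * (σ (z' k) - σ (z k)) - (deriv σ (-B) + deriv σ B) * (z' k - z k)) =
      2 * ∑ k, w k * (σ (z' k) - σ (z k))
        - 2 * ∑ k, w k * ((deriv σ (-B) + deriv σ B) / 2 * (z' k - z k)) := by
    rw [Finset.mul_sum, Finset.mul_sum, ← Finset.sum_sub_distrib]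
    exact Finset.sum_congr rfl fun k _ => by ring
  linarith

end Activation

section Network

variable {E : Type*} [NormedAddCommGroup E] [InnerProductSpace ℝ E] {m n : ℕ}

lemma sum_mul_le_of_sum_sq_le {ι : Type*} [Fintype ι] (u v : ι → ℝ) {D : ℝ} (hD : 0 ≤ D)
    (hu : ∑ r, u r ^ 2 ≤ D ^ 2) : ∑ r, u r * v r ≤ D * √(∑ r, v r ^ 2) := by
  refine (Real.sum_mul_le_sqrt_mul_sqrt univ u v).trans ?_
  gcongr
  exact Real.sqrt_le_iff.2 ⟨hD, hu⟩

lemma sum_linear_network_le (x : Fin n → E) (hx : ∀ i, ‖x i‖ ≤ 1) (b : Fin m → ℝ) {K D : ℝ}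
    (hb : ∀ r, |b r| ≤ K) (hK : 0 ≤ K) (hD : 0 ≤ D) (V : (Fin n → Bool) → Fin m → E)
    (hV : ∀ ε, ∑ r, ‖V ε r‖ ^ 2 ≤ D ^ 2) :
    ∑ ε, ∑ r, ∑ i, boolSign (ε i) * (b r * ⟪V ε r, x i⟫) ≤ 2 ^ n * (K * D * √m * √n) := by
  have h := sum_norm_rademacher_sum_le x hx
  rw [Fintype.card_fin] at h
  calc _ ≤ ∑ ε : Fin n → Bool, K * D * √m * ‖∑ i, boolSign (ε i) • x i‖ := by
        refine Finset.sum_le_sum fun ε _ => ?_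
        calc ∑ r, ∑ i, boolSign (ε i) * (b r * ⟪V ε r, x i⟫)
            ≤ ∑ r, ‖V ε r‖ * (K * ‖∑ i, boolSign (ε i) • x i‖) := by
              refine Finset.sum_le_sum fun r _ => ?_
              have e : ∑ i, boolSign (ε i) * (b r * ⟪V ε r, x i⟫)
                  = b r * ⟪V ε r, ∑ i, boolSign (ε i) • x i⟫ := by
                rw [inner_sum, Finset.mul_sum]
                exact Finset.sum_congr rfl fun i _ => by rw [real_inner_smul_right]; ring
              rw [e]
              refine (le_abs_self _).trans ?_
              rw [abs_mul]
              calc |b r| * |⟪V ε r, ∑ i, boolSign (ε i) • x i⟫|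
                  ≤ K * (‖V ε r‖ * ‖∑ i, boolSign (ε i) • x i‖) :=
                    mul_le_mul (hb r) (abs_real_inner_le_norm _ _) (abs_nonneg _) hK
                _ = _ := by ring
          _ ≤ D * √(∑ _r : Fin m, (K * ‖∑ i, boolSign (ε i) • x i‖) ^ 2) :=
              sum_mul_le_of_sum_sq_le _ _ hD (hV ε)
          _ = _ := by
              rw [Finset.sum_const, Finset.card_univ, Fintype.card_fin, nsmul_eq_mul,
                Real.sqrt_mul (by positivity), Real.sqrt_sq (by positivity)]
              ring
    _ = K * D * √m * ∑ ε : Fin n → Bool, ‖∑ i, boolSign (ε i) • x i‖ := by rw [Finset.mul_sum]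
    _ ≤ K * D * √m * (2 ^ n * √n) := by gcongr
    _ = _ := by ring

lemma sum_abs_network_le (x : Fin n → E) (hx : ∀ i, ‖x i‖ ≤ 1) (a : Fin m → ℝ)
    (ha : ∀ r, |a r| = 1) {D : ℝ} (hD : 0 ≤ D) (c : Fin m → Fin n → ℝ)
    (V : (Fin n → Bool) → Fin m → E) (hV : ∀ ε, ∑ r, ‖V ε r‖ ^ 2 ≤ D ^ 2) :
    ∑ ε, ∑ r, ∑ i, boolSign (ε i) * (a r * (|c r i + ⟪V ε r, x i⟫| - |c r i|))
      ≤ 2 ^ n * (4 * D * √m * √n) := by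
  choose Z hZ hle using fun r => exists_neuron_envelope x hx (c r) (a r) (ha r)
  have hZsum : ∑ ε, √(∑ r, Z r ε ^ 2) ≤ 2 ^ n * (4 * √m * √n) := by
    have h := sum_le_of_sum_sq_le (fun ε => √(∑ r, Z r ε ^ 2)) (4 * √m * √n) (by positivity)
    rw [Fintype.card_fin] at h
    refine h ?_
    rw [Finset.sum_congr rfl fun ε _ =>
      Real.sq_sqrt (Finset.sum_nonneg fun r _ => sq_nonneg (Z r ε)), Finset.sum_comm]
    calc ∑ r, ∑ ε, Z r ε ^ 2 ≤ ∑ _r : Fin m, 2 ^ n * (10 * (n : ℝ)) :=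
          Finset.sum_le_sum fun r _ => hZ r
      _ = 2 ^ n * (10 * (m * n)) := by simp; ring
      _ ≤ 2 ^ n * (16 * (m * n)) := by gcongr; norm_num
      _ = _ := by
          rw [mul_pow, mul_pow, Real.sq_sqrt (by positivity), Real.sq_sqrt (by positivity)]
          ring
  calc _ ≤ ∑ ε, D * √(∑ r, Z r ε ^ 2) := Finset.sum_le_sum fun ε _ =>
        (Finset.sum_le_sum fun r _ => hle r ε (V ε r)).trans
          (sum_mul_le_of_sum_sq_le _ _ hD (hV ε))
    _ = D * ∑ ε, √(∑ r, Z r ε ^ 2) := by rw [Finset.mul_sum]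
    _ ≤ D * (2 ^ n * (4 * √m * √n)) := by gcongr
    _ = _ := by ring

lemma sum_convex_network_le {σ : ℝ → ℝ} {K D : ℝ} (hσ : ContDiff ℝ 2 σ)
    (hK : ∀ z, |deriv σ z| ≤ K) (hconv : ConvexOn ℝ Set.univ σ)
    (x : Fin n → E) (hx : ∀ i, ‖x i‖ ≤ 1) (a : Fin m → ℝ)
    (ha : ∀ r, |a r| = 1) (hD : 0 ≤ D) (θ₀ : Fin m → E)
    (V : (Fin n → Bool) → Fin m → E) (hV : ∀ ε, ∑ r, ‖V ε r‖ ^ 2 ≤ D ^ 2) :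
    ∑ ε, ∑ r, ∑ i, boolSign (ε i) * (a r * (σ ⟪θ₀ r + V ε r, x i⟫ - σ ⟪θ₀ r, x i⟫))
      ≤ 2 ^ n * (5 * K * D * √m * √n) := by
  have hK0 : 0 ≤ K := (abs_nonneg _).trans (hK 0)
  have hθ : ∀ r, ‖θ₀ r‖ ≤ ∑ r, ‖θ₀ r‖ := fun r =>
    Finset.single_le_sum (fun r _ => norm_nonneg (θ₀ r)) (mem_univ r)
  have hVr : ∀ ε r, ‖V ε r‖ ≤ D := fun ε r =>
    (le_abs_self _).trans (abs_le_of_sq_le_sq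
      ((Finset.single_le_sum (fun r _ => sq_nonneg ‖V ε r‖) (mem_univ r)).trans (hV ε)) hD)
  have hin : ∀ (u : E) (i : Fin n), |⟪u, x i⟫| ≤ ‖u‖ := fun u i =>
    (abs_real_inner_le_norm _ _).trans (mul_le_of_le_one_right (norm_nonneg _) (hx i))
  let B := ∑ r, ‖θ₀ r‖ + D
  have hB : 0 ≤ B := by positivity
  have h := sum_mul_convex_sub_le (κ := (Fin n → Bool) × Fin m × Fin n)
    (C := 2 ^ n * (4 * D * √m * √n)) hσ hK hconv hB (by positivity)
    (fun k => boolSign (k.1 k.2.2) * a k.2.1) (fun k => ⟪θ₀ k.2.1, x k.2.2⟫)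
    (fun k => ⟪θ₀ k.2.1 + V k.1 k.2.1, x k.2.2⟫)
    (fun k => (hin _ _).trans ((hθ _).trans (le_add_of_nonneg_right hD)))
    (fun k => (hin _ _).trans ((norm_add_le _ _).trans (add_le_add (hθ _) (hVr _ _)))) (by
      intro s
      have h' := sum_abs_network_le x hx a ha hD (fun r i => ⟪θ₀ r, x i⟫ - s) V hV
      simp only [Fintype.sum_prod_type]
      refine le_of_eq_of_le (Finset.sum_congr rfl fun ε _ => Finset.sum_congr rfl fun r _ =>
        Finset.sum_congr rfl fun i _ => ?_) h'
      rw [inner_add_left, add_sub_right_comm, mul_assoc])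
  have hlin : ∀ r, |a r * ((deriv σ (-B) + deriv σ B) / 2)| ≤ K := by
    intro r
    rw [abs_mul, ha, one_mul, abs_le]
    have h1 := abs_le.1 (hK B)
    have h2 := abs_le.1 (hK (-B))
    constructor <;> linarith [h1.1, h1.2, h2.1, h2.2]
  have h2 := sum_linear_network_le x hx _ hlin hK0 hD V hV
  simp only [Fintype.sum_prod_type, inner_add_left, add_sub_cancel_left] at h
  simp only [mul_assoc, inner_add_left] at h h2 ⊢
  linarith

end Network

lemma abs_ramp_sub_le {γ : ℝ} (hγ : 0 < γ) (u v : ℝ) :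
    |ramp γ u - ramp γ v| ≤ |u / γ - v / γ| := by
  have e : ∀ v, ramp γ v = max 0 (min 1 (1 - v / γ)) := by
    intro v
    unfold ramp
    split_ifs with h1 h2
    · have : v / γ < 0 := div_neg_of_neg_of_pos h1 hγ
      rw [min_eq_left (by linarith), max_eq_right zero_le_one]
    · have h3 : 0 ≤ v / γ := div_nonneg (not_lt.1 h1) hγ.le
      have h4 : v / γ ≤ 1 := (div_le_one hγ).2 h2
      rw [min_eq_right (by linarith), max_eq_right (by linarith)]
    · have : 1 < v / γ := (one_lt_div hγ).2 (not_le.1 h2)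
      rw [min_eq_right (by linarith), max_eq_left (by linarith)]
  rw [e, e]
  rw [max_comm 0, max_comm 0]
  refine (abs_max_sub_max_le_abs _ _ (0 : ℝ)).trans ((abs_min_sub_min_le_max _ _ _ _).trans ?_)
  rw [sub_self, abs_zero, max_eq_right (abs_nonneg _), abs_sub_comm]
  apply le_of_eq
  congr 1
  ring

/-- Deterministic form of the Rademacher complexity bound: it holds for every centre. -/
lemma rade_le (d m n : ℕ) (hm : 0 < m) (hn : 0 < n) {σ : ℝ → ℝ} {K : ℝ}
    (hσ : ContDiff ℝ 2 σ) (hK : ∀ z, |deriv σ z| ≤ K) (hconv : ConvexOn ℝ Set.univ σ)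
    (a : Fin m → ℝ) (ha : ∀ r, |a r| = 1)
    (x : Fin n → EuclideanSpace ℝ (Fin d)) (y : Fin n → ℝ)
    (hx : ∀ i, ‖x i‖ ≤ 1) (hy : ∀ i, |y i| = 1)
    {β γ D : ℝ} (hγ : 0 < γ) (hD : 0 ≤ D) (Θ0 : Fin m → EuclideanSpace ℝ (Fin d)) :
    rade d m n β γ D σ a x y Θ0 ≤
      5 * K * (m : ℝ) ^ ((1 : ℝ) / 2 - β) / (γ * √n) * D := by
  have hm' : (0 : ℝ) < m := by exact_mod_cast hm
  have hn' : (0 : ℝ) < n := by exact_mod_cast hn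
  let T := {Θ : Fin m → EuclideanSpace ℝ (Fin d) // en2 d m (fun r => Θ r - Θ0 r) ≤ D}
  let f : Fin n → T → ℝ := fun i Θ => fnet d m β σ a Θ.1 (x i)
  have hsel : ∀ τ : (Fin n → Bool) → T,
      ∑ ε, ∑ i, boolSign (ε i) * ramp γ (y i * f i (τ ε)) ≤
        2 ^ n * ((m : ℝ) ^ (-β) / γ * (5 * K * D * √m * √n)) := by
    intro τ
    obtain ⟨τ', hτ'⟩ := exists_selection_contraction
      (fun i Θ => ramp γ (y i * f i Θ)) (fun i Θ => f i Θ / γ) (by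
        intro i s t
        refine (abs_ramp_sub_le hγ _ _).trans_eq ?_
        rw [mul_div_assoc, mul_div_assoc, ← mul_sub, abs_mul, hy, one_mul]) τ
    refine hτ'.trans ?_
    have hV : ∀ ε, ∑ r, ‖(τ' ε).1 r - Θ0 r‖ ^ 2 ≤ D ^ 2 := fun ε =>
      (Real.sqrt_le_left hD).1 (τ' ε).2
    have h := sum_convex_network_le hσ hK hconv x hx a ha hD Θ0 (fun ε r => (τ' ε).1 r - Θ0 r) hV
    simp only [add_sub_cancel] at h
    have h0 : ∑ ε : Fin n → Bool, ∑ i, boolSign (ε i) * (fnet d m β σ a Θ0 (x i) / γ) = 0 := by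
      rw [Finset.sum_comm]
      exact Finset.sum_eq_zero fun i _ => sum_boolSign_mul_eq_zero i _ fun _ => rfl
    have e : ∑ ε, ∑ i, boolSign (ε i) * (f i (τ' ε) / γ) =
        ∑ ε : Fin n → Bool, ∑ i, boolSign (ε i) * (fnet d m β σ a Θ0 (x i) / γ) +
        (m : ℝ) ^ (-β) / γ * ∑ ε, ∑ r, ∑ i,
          boolSign (ε i) * (a r * (σ ⟪(τ' ε).1 r, x i⟫ - σ ⟪Θ0 r, x i⟫)) := by
      rw [Finset.mul_sum, ← Finset.sum_add_distrib]
      refine Finset.sum_congr rfl fun ε _ => ?_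
      rw [Finset.sum_comm (s := univ (α := Fin m)), Finset.mul_sum, ← Finset.sum_add_distrib]
      refine Finset.sum_congr rfl fun i _ => ?_
      simp only [f, fnet]
      rw [← Finset.mul_sum]
      simp only [mul_sub, Finset.sum_sub_distrib]
      ring
    rw [e, h0, zero_add]
    calc _ ≤ (m : ℝ) ^ (-β) / γ * (2 ^ n * (5 * K * D * √m * √n)) := by gcongr
      _ = _ := by ring
  have hΘ0 : en2 d m (fun r => Θ0 r - Θ0 r) ≤ D := by simpa [en2, nsq] using hD
  let S : (Fin n → Bool) → Set ℝ := fun ε => {z : ℝ | ∃ Θ : Fin m → EuclideanSpace ℝ (Fin d),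
      en2 d m (fun r => Θ r - Θ0 r) ≤ D ∧
      z = ∑ i, (if ε i then (1 : ℝ) else -1) * ramp γ (y i * fnet d m β σ a Θ (x i))}
  have hS : ∀ ε, (S ε).Nonempty := fun ε => ⟨_, Θ0, hΘ0, rfl⟩
  have hsup : ∑ ε, sSup (S ε) ≤ 2 ^ n * ((m : ℝ) ^ (-β) / γ * (5 * K * D * √m * √n)) := by
    refine le_of_forall_pos_le_add fun η hη => ?_
    have hex : ∀ ε, ∃ q : T, sSup (S ε) - η / 2 ^ n <
        ∑ i, boolSign (ε i) * ramp γ (y i * f i q) := by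
      intro ε
      obtain ⟨_, ⟨Θ, hΘ, rfl⟩, hlt⟩ := exists_lt_of_lt_csSup (hS ε)
        (sub_lt_self (sSup (S ε)) (by positivity : 0 < η / 2 ^ n))
      exact ⟨⟨Θ, hΘ⟩, hlt⟩
    choose q hq using hex
    have h1 := hsel q
    have h2 := Finset.sum_le_sum fun ε (_ : ε ∈ univ) => (hq ε).le
    rw [Finset.sum_sub_distrib] at h2
    simp only [Finset.sum_const, Finset.card_univ, Fintype.card_fun, Fintype.card_bool,
      Fintype.card_fin, nsmul_eq_mul, Nat.cast_pow, Nat.cast_ofNat] at h2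
    rw [mul_div_cancel₀ _ (by positivity)] at h2
    linarith
  calc rade d m n β γ D σ a x y Θ0
      = (1 / n : ℝ) * (1 / 2 ^ n : ℝ) * ∑ ε, sSup (S ε) := rfl
    _ ≤ (1 / n : ℝ) * (1 / 2 ^ n : ℝ) *
        (2 ^ n * ((m : ℝ) ^ (-β) / γ * (5 * K * D * √m * √n))) := by gcongr
    _ = _ := by
      rw [sub_eq_add_neg, Real.rpow_add hm', ← Real.sqrt_eq_rpow]
      have hs : √(n : ℝ) ≠ 0 := (Real.sqrt_pos.2 hn').ne'
      have hsn : (n : ℝ) = √n * √n := (Real.mul_self_sqrt hn'.le).symm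
      have : (1 / n : ℝ) = 1 / (√n * √n) := by rw [← hsn]
      rw [this]
      field_simp

/-- Proposition 6, second part: dimension-free Rademacher complexity bound
for convex `σ` with `σ(0) = 0`. -/
theorem rademacher_bound_convex
    (d m n : ℕ) (hm : 0 < m) (hn : 0 < n)
    (σ : ℝ → ℝ) (K₁ K₂ : ℝ)
    (hσ : ContDiff ℝ 2 σ)
    (hK₁ : ∀ z, |deriv σ z| ≤ K₁)
    (hK₂ : ∀ z, |deriv (deriv σ) z| ≤ K₂)
    (hconv : ConvexOn ℝ Set.univ σ) (hσ0 : σ 0 = 0)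
    (a : Fin m → ℝ) (ha : ∀ r, a r = 1 ∨ a r = -1)
    (x : Fin n → EuclideanSpace ℝ (Fin d)) (y : Fin n → ℝ)
    (hx : ∀ i, ‖x i‖ ≤ 1) (hy : ∀ i, y i = 1 ∨ y i = -1)
    (μ₀ : Measure (EuclideanSpace ℝ (Fin d))) [IsProbabilityMeasure μ₀]
    (A b : ℝ) (hA : 0 < A) (hb : 0 < b)
    (hsub : ∀ t : ℝ, 0 < t → μ₀ {θ | t ≤ ‖θ‖} ≤ ENNReal.ofReal (A * Real.exp (-b * t ^ 2)))
    (β γ D δ : ℝ) (hβ0 : 0 ≤ β) (hβ1 : β < 1)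
    (hγ : 0 < γ) (hD : 0 < D) (hδ0 : 0 < δ) (hδ1 : δ < 1) :
    ENNReal.ofReal (1 - δ) ≤
      (Measure.pi fun _ : Fin m => μ₀) {Θ0 |
        rade d m n β γ D σ a x y Θ0 ≤
          8 * K₁ * (m : ℝ) ^ ((1 : ℝ) / 2 - β) / (γ * Real.sqrt n) *
            (D + Real.sqrt (Real.log (A * m / δ) / b))} := by
  have hK0 : 0 ≤ K₁ := (abs_nonneg _).trans (hK₁ 0)
  have huniv : {Θ0 | rade d m n β γ D σ a x y Θ0 ≤
      8 * K₁ * (m : ℝ) ^ ((1 : ℝ) / 2 - β) / (γ * Real.sqrt n) *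
        (D + Real.sqrt (Real.log (A * m / δ) / b))} = Set.univ := by
    refine Set.eq_univ_of_forall fun Θ0 => ?_
    have ha' : ∀ r, |a r| = 1 := fun r => by rcases ha r with h | h <;> simp [h]
    have hy' : ∀ i, |y i| = 1 := fun i => by rcases hy i with h | h <;> simp [h]
    refine (rade_le d m n hm hn hσ hK₁ hconv a ha' x y hx hy' hγ hD.le Θ0).trans ?_
    gcongr
    · norm_num
    · exact le_add_of_nonneg_right (Real.sqrt_nonneg _)
  rw [huniv, measure_univ]
  exact ENNReal.ofReal_le_one.2 (by linarith)
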